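/- There is a Borel map from End_𝒟𝒢 to End_𝓑𝒟 that assigns to every pair (G, φ), where G ∈ 𝒟𝒢 codes a dimension group and φ is a positive endomorphism of G, a pair (T^G, q^{G,φ}), where T^G is a Bratteli diagram and q^{G,φ} is an endomorphism of T^G, such that the dimension group associated with T^G is isomorphic to G as an ordered abelian group with order unit via an isomorphism θ satisfying θ ∘ ψ = φ ∘ θ, where ψ is the endomorphism of the dimension group associated with T^G induced by q^{G,φ}. -/

import Mathlib

open Finset

/-- `f : ℕ × ℕ → ℕ` codes a group structure on `ℕ`, written `a + b = f (a, b)`. -/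
def IsGroupCode (f : ℕ × ℕ → ℕ) : Prop :=
  (∀ a b c, f (f (a, b), c) = f (a, f (b, c))) ∧
    ∃ e, (∀ a, f (e, a) = a ∧ f (a, e) = a) ∧ ∀ a, ∃ b, f (a, b) = e ∧ f (b, a) = e

/-- `e` is the identity element of the group coded by `f`. -/
def IsIdentityOf (f : ℕ × ℕ → ℕ) (e : ℕ) : Prop :=
  ∀ a, f (e, a) = a ∧ f (a, e) = a

/-- `codeSmul f e x n` is `n • x` in the (additively written) group coded by `f` with
identity `e`. -/
def codeSmul (f : ℕ × ℕ → ℕ) (e x : ℕ) : ℕ → ℕ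
  | 0 => e
  | n + 1 => f (x, codeSmul f e x n)

/-- The order on the group coded by `f` with positive cone `{d | P d = true}`:
`x ≤ y` iff `y = x + d` for some `d` in the cone. -/
def codeLe (f : ℕ × ℕ → ℕ) (P : ℕ → Bool) (x y : ℕ) : Prop :=
  ∃ d, P d = true ∧ f (x, d) = y

/-- `(f, P, u)` codes a dimension group: an unperforated ordered abelian group with the
Riesz interpolation property, with positive cone `{x | P x = true}` and order unit `u`. -/
def IsDimGroupCode (f : ℕ × ℕ → ℕ) (P : ℕ → Bool) (u : ℕ) : Prop :=
  IsGroupCode f ∧ (∀ a b, f (a, b) = f (b, a)) ∧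
  (∀ a b, P a = true → P b = true → P (f (a, b)) = true) ∧
  ∀ e, IsIdentityOf f e →
    P e = true ∧
    -- `G⁺ ∩ (−G⁺) = {0}`
    (∀ a b, P a = true → P b = true → f (a, b) = e → a = e) ∧
    -- `G⁺ − G⁺ = G`
    (∀ x, ∃ a b, P a = true ∧ P b = true ∧ f (x, b) = a) ∧
    -- unperforated
    (∀ x n, 1 ≤ n → P (codeSmul f e x n) = true → P x = true) ∧
    -- Riesz interpolation
    (∀ x0 x1 y0 y1, codeLe f P x0 y0 → codeLe f P x0 y1 →
      codeLe f P x1 y0 → codeLe f P x1 y1 →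
      ∃ z, codeLe f P x0 z ∧ codeLe f P x1 z ∧ codeLe f P z y0 ∧ codeLe f P z y1) ∧
    -- `u` is an order unit: `u ∈ G⁺` and for every `x` there is `n` with
    -- `x ≤ n·u` and `−n·u ≤ x` (the latter says `x + n·u ∈ G⁺`).
    (P u = true ∧ ∀ x, ∃ n, codeLe f P x (codeSmul f e u n) ∧
      P (f (x, codeSmul f e u n)) = true)

/-- The standard Borel space `𝒟𝒢` of codes for dimension groups. -/
def DGCode : Set ((ℕ × ℕ → ℕ) × (ℕ → Bool) × ℕ) :=
  {x | IsDimGroupCode x.1 x.2.1 x.2.2}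

/-- `(l, w, m)` is a Bratteli diagram. -/
def IsBratteli (l : ℕ → ℕ) (w : ℕ → ℕ → ℕ) (m : ℕ → ℕ × ℕ → ℕ) : Prop :=
  l 0 = 1 ∧ w 0 0 = 1 ∧ (∀ n i, 0 < w n i ↔ i < l n) ∧
  (∀ n i j, l n ≤ i ∨ l (n + 1) ≤ j → m n (i, j) = 0) ∧
  ∀ n j, j < l (n + 1) → w (n + 1) j = ∑ i ∈ range (l n), m n (i, j) * w n i

/-- The standard Borel space `𝓑𝒟` of Bratteli diagrams. -/
def BDCode : Set ((ℕ → ℕ) × (ℕ → ℕ → ℕ) × (ℕ → ℕ × ℕ → ℕ)) :=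
  {x | IsBratteli x.1 x.2.1 x.2.2}

/-- The connecting homomorphism `ℤ^{l(n)} → ℤ^{l(n+1)}`, `φ_n(e_i) = Σ_j m_n(i,j)·e_j`,
of the inductive system associated with a Bratteli diagram (vectors in `ℤ^{l(n)}` are
represented as finitely supported functions `ℕ → ℤ` vanishing at indices `≥ l(n)`). -/
def stepMap (l : ℕ → ℕ) (m : ℕ → ℕ × ℕ → ℕ) (n : ℕ) (x : ℕ → ℤ) : ℕ → ℤ :=
  fun j => if j < l (n + 1) then ∑ i ∈ range (l n), (m n (i, j) : ℤ) * x i else 0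

/-- The composite connecting map from level `n` to level `n + k`. -/
def iterStep (l : ℕ → ℕ) (m : ℕ → ℕ × ℕ → ℕ) (n : ℕ) : ℕ → (ℕ → ℤ) → ℕ → ℤ
  | 0 => fun x => x
  | k + 1 => fun x => stepMap l m (n + k) (iterStep l m n k x)

/-- `x : ℕ → ℤ` represents an element of `ℤ^{l(n)}`. -/
def SuppLt (l : ℕ → ℕ) (n : ℕ) (x : ℕ → ℤ) : Prop :=
  ∀ i, l n ≤ i → x i = 0

/-- The order unit `(w_n(0), …, w_n(l(n)−1))` of `ℤ^{l(n)}`. -/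
def unitVec (l : ℕ → ℕ) (w : ℕ → ℕ → ℕ) (n : ℕ) : ℕ → ℤ :=
  fun i => if i < l n then (w n i : ℤ) else 0

/-- `θ` codes an isomorphism of ordered abelian groups with order unit from the dimension
group associated with the Bratteli diagram `(l, w, m)` (the direct limit of the system
`(ℤ^{l(n)}, ℕ^{l(n)}, w_n)` with connecting maps `stepMap`) onto the dimension group
coded by `(f, P, u)`.  `θ n` is the composition of the canonical map
`φ_{n,∞} : ℤ^{l(n)} → lim` with the isomorphism: the conditions say that each `θ n` is
additive, compatible with the connecting maps, jointly surjective; that `θ n x = 0` iff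
`x` is eventually killed by the connecting maps (injectivity on the limit); that
`θ n x ≥ 0` iff `x` is eventually mapped into the positive cone `ℕ^{l(n+k)}` (order
isomorphism); and that the order unit is mapped to `u`. -/
def IsLimitIso (l : ℕ → ℕ) (w : ℕ → ℕ → ℕ) (m : ℕ → ℕ × ℕ → ℕ)
    (f : ℕ × ℕ → ℕ) (P : ℕ → Bool) (u : ℕ) (θ : ℕ → (ℕ → ℤ) → ℕ) : Prop :=
  ∀ e, IsIdentityOf f e →
    (∀ n x y, SuppLt l n x → SuppLt l n y →
      θ n (fun i => x i + y i) = f (θ n x, θ n y)) ∧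
    (∀ n x, SuppLt l n x → θ (n + 1) (stepMap l m n x) = θ n x) ∧
    (∀ g : ℕ, ∃ n x, SuppLt l n x ∧ θ n x = g) ∧
    (∀ n x, SuppLt l n x → (θ n x = e ↔ ∃ k, iterStep l m n k x = fun _ => 0)) ∧
    (∀ n x, SuppLt l n x →
      (P (θ n x) = true ↔ ∃ k, ∀ j, 0 ≤ iterStep l m n k x j)) ∧
    θ 0 (unitVec l w 0) = u

/-- `φ` is a homomorphism between the groups coded by `f` and `g`. -/
def IsHomCode (f g : ℕ × ℕ → ℕ) (φ : ℕ → ℕ) : Prop :=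
  ∀ a b, φ (f (a, b)) = g (φ a, φ b)

/-- `φ` is a positive endomorphism of the dimension group coded by `(f, P, u)`. -/
def IsPosEndoCode (f : ℕ × ℕ → ℕ) (P : ℕ → Bool) (φ : ℕ → ℕ) : Prop :=
  IsHomCode f f φ ∧ ∀ a, P a = true → P (φ a) = true

/-- The standard Borel space `End_𝒟𝒢` of dimension groups together with a positive
endomorphism. -/
def EndDGCode : Set (((ℕ × ℕ → ℕ) × (ℕ → Bool) × ℕ) × (ℕ → ℕ)) :=
  {x | x.1 ∈ DGCode ∧ IsPosEndoCode x.1.1 x.1.2.1 x.2}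

/-- `q` is an endomorphism of the Bratteli diagram `(l, w, m)`. -/
def IsBDEndoCode (l : ℕ → ℕ) (m : ℕ → ℕ × ℕ → ℕ) (q : ℕ → ℕ × ℕ → ℕ) : Prop :=
  ∀ n i t', i < l n → t' < l (n + 2) →
    ∑ t ∈ range (l (n + 1)), m n (i, t) * q (n + 1) (t, t') =
      ∑ t ∈ range (l (n + 1)), q n (i, t) * m (n + 1) (t, t')

/-- The standard Borel space `End_𝓑𝒟` of Bratteli diagrams together with an
endomorphism. -/
def EndBDCode :
    Set (((ℕ → ℕ) × (ℕ → ℕ → ℕ) × (ℕ → ℕ × ℕ → ℕ)) × (ℕ → ℕ × ℕ → ℕ)) :=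
  {y | y.1 ∈ BDCode ∧ IsBDEndoCode y.1.1 y.1.2.2 y.2}

/-- The level-`n` map `ψ_n : ℤ^{l(n)} → ℤ^{l(n+1)}`, `ψ_n(e_i) = Σ_j q_n(i,j)·e_j`,
inducing the endomorphism of the associated dimension group determined by a Bratteli
diagram endomorphism `q`. -/
def qStep (l : ℕ → ℕ) (q : ℕ → ℕ × ℕ → ℕ) (n : ℕ) (x : ℕ → ℤ) : ℕ → ℤ :=
  fun j => if j < l (n + 1) then ∑ i ∈ range (l n), (q n (i, j) : ℤ) * x i else 0

section Algebra

variable {G : Type} [AddCommGroup G] [PartialOrder G]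

/-- The Riesz interpolation property. -/
def HasInterpolation (G : Type) [PartialOrder G] : Prop :=
  ∀ x₀ x₁ y₀ y₁ : G, x₀ ≤ y₀ → x₀ ≤ y₁ → x₁ ≤ y₀ → x₁ ≤ y₁ →
    ∃ z, x₀ ≤ z ∧ x₁ ≤ z ∧ z ≤ y₀ ∧ z ≤ y₁

/-- Unperforated ordered groups. -/
def IsUnperforated (G : Type) [AddCommGroup G] [PartialOrder G] : Prop :=
  ∀ (x : G) (n : ℕ), 1 ≤ n → 0 ≤ n • x → 0 ≤ x

/-- The Riesz decomposition property for finite sums. -/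
lemma HasInterpolation.exists_decomposition [IsOrderedAddMonoid G] (hI : HasInterpolation G)
    {ι : Type} (s : Finset ι) (y : ι → G) (hy : ∀ i, 0 ≤ y i) :
    ∀ x : G, 0 ≤ x → x ≤ ∑ i ∈ s, y i →
      ∃ t : ι → G, (∀ i, 0 ≤ t i ∧ t i ≤ y i) ∧ (∀ i ∉ s, t i = 0) ∧ ∑ i ∈ s, t i = x := by
  classical
  induction s using Finset.induction_on with
  | empty =>
    intro x hx hxs
    exact ⟨fun _ => 0, fun i => ⟨le_rfl, hy i⟩, fun _ _ => rfl, by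
      simpa using le_antisymm hx (by simpa using hxs)⟩
  | insert a s ha ih =>
    intro x hx hxs
    rw [sum_insert ha] at hxs
    obtain ⟨z, hz0, hz1, hz2, hz3⟩ := hI 0 (x - ∑ i ∈ s, y i) x (y a) hx (hy a)
      (sub_le_self _ (sum_nonneg fun i _ => hy i)) (sub_le_iff_le_add.2 hxs)
    obtain ⟨t, ht, hts, htx⟩ := ih (x - z) (sub_nonneg.2 hz2) (sub_le_comm.1 hz1)
    refine ⟨Function.update t a z, fun i => ?_, fun i hi => ?_, ?_⟩
    · rcases eq_or_ne i a with rfl | h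
      · simpa using ⟨hz0, hz3⟩
      · simpa [h] using ht i
    · rw [mem_insert, not_or] at hi
      simpa [hi.1] using hts i hi.2
    · rw [sum_insert ha, sum_update_of_notMem ha, htx]
      simp

/-- A homomorphism between ordered groups mapping the positive cone to the positive cone. -/
def IsPosHom {A B : Type} [AddCommGroup A] [LE A] [AddCommGroup B] [LE B] (h : A →+ B) : Prop :=
  ∀ x : A, 0 ≤ x → 0 ≤ h x

lemma addMonoidHom_apply_eq_sum {ι : Type} [Fintype ι] [DecidableEq ι] {H : Type}
    [AddCommGroup H] (h : (ι → ℤ) →+ H) (x : ι → ℤ) :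
    h x = ∑ i, x i • h (Pi.single i 1) := by
  conv_lhs => rw [← Finset.univ_sum_single x]
  rw [map_sum]
  refine sum_congr rfl fun i _ => ?_
  rw [← map_zsmul]
  congr 1
  ext j
  simp [Pi.single_apply]

/-- The homomorphism `ℤ^ι → G` with prescribed values on the standard basis. -/
def homOfBasis {ι : Type} [Fintype ι] {H : Type} [AddCommGroup H] (g : ι → H) : (ι → ℤ) →+ H where
  toFun x := ∑ i, x i • g i
  map_zero' := by simp
  map_add' x y := by simp [add_smul, sum_add_distrib]

lemma homOfBasis_apply {ι : Type} [Fintype ι] {H : Type} [AddCommGroup H] (g : ι → H)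
    (x : ι → ℤ) : homOfBasis g x = ∑ i, x i • g i := rfl

lemma isPosHom_homOfBasis [IsOrderedAddMonoid G] {ι : Type} [Fintype ι] {g : ι → G}
    (hg : ∀ i, 0 ≤ g i) :
    IsPosHom (homOfBasis g) := fun _ hx =>
  sum_nonneg fun i _ => zsmul_nonneg (hg i) (hx i)

/-- `θ` factors positively through a simplicial group in such a way that `c` is killed. -/
def KillsThrough {ι : Type} (θ : (ι → ℤ) →+ G) (c : Set (ι → ℤ)) : Prop :=
  ∃ (κ : Type) (_ : Fintype κ) (σ : (ι → ℤ) →+ (κ → ℤ)) (θ' : (κ → ℤ) →+ G),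
    IsPosHom σ ∧ IsPosHom θ' ∧ (∀ x, θ' (σ x) = θ x) ∧ ∀ x ∈ c, σ x = 0

lemma KillsThrough.comp {ι κ : Type} [Fintype κ] {θ : (ι → ℤ) →+ G} {σ : (ι → ℤ) →+ (κ → ℤ)}
    {θ' : (κ → ℤ) →+ G} (hσ : IsPosHom σ) (h : ∀ x, θ' (σ x) = θ x) {c : Set (ι → ℤ)}
    (hk : KillsThrough θ' (σ '' c)) : KillsThrough θ c := by
  obtain ⟨μ, _, τ, θ'', hτ, hθ'', hc, hk⟩ := hk
  exact ⟨μ, inferInstance, τ.comp σ, θ'', fun x hx => hτ _ (hσ _ hx), hθ'',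
    fun x => by simp [hc, h], fun x hx => hk _ ⟨x, hx, rfl⟩⟩

/-- The reduction step in Shen's argument: a maximal coefficient `c a > 0` of a relation `c` can
be removed at the cost of adding strictly smaller coefficients. -/
lemma exists_reduction [IsOrderedAddMonoid G] (hI : HasInterpolation G)
    (hU : IsUnperforated G) {ι : Type} [Fintype ι] (θ : (ι → ℤ) →+ G) (hθ : IsPosHom θ)
    (c : ι → ℤ) (hc : θ c = 0) (a : ι)
    (ha : 0 < c a) (hmax : ∀ i, |c i| ≤ c a) :
    ∃ (σ : (ι → ℤ) →+ (ι ⊕ ι → ℤ)) (θ' : (ι ⊕ ι → ℤ) →+ G),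
      IsPosHom σ ∧ IsPosHom θ' ∧ (∀ x, θ' (σ x) = θ x) ∧
      (∀ i, i ≠ a → σ c (.inl i) = c i) ∧ σ c (.inl a) = 0 ∧
      ∀ i, |σ c (.inr i)| < c a := by
  classical
  set g : ι → G := fun i => θ (Pi.single i 1) with hg
  have hg0 : ∀ i, 0 ≤ g i := fun i => hθ _ (by simp)
  set B : Finset ι := univ.filter fun i => c i < 0 with hB
  have haB : a ∉ B := by simp [hB, ha.le]
  have hle : g a ≤ ∑ i ∈ B, g i := by
    rw [← sub_nonneg]
    refine hU _ (c a).toNat (by omega) ?_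
    rw [← natCast_zsmul, Int.toNat_of_nonneg ha.le, smul_sub, sub_nonneg, smul_sum]
    have h0 : ∑ i, c i • g i = 0 := by rw [← addMonoidHom_apply_eq_sum, hc]
    have h1 : ∑ i ∈ univ.filter (fun i => ¬ c i < 0), c i • g i = ∑ i ∈ B, (-c i) • g i := by
      rw [← sum_filter_add_sum_filter_not univ (fun i => c i < 0)] at h0
      simp only [neg_smul, sum_neg_distrib]
      exact eq_neg_of_add_eq_zero_right h0
    calc c a • g a ≤ ∑ i ∈ univ.filter (fun i => ¬ c i < 0), c i • g i :=
          single_le_sum (f := fun i => c i • g i) (fun i hi => zsmul_nonneg (hg0 i)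
            (by simpa using hi)) (by simpa using ha.le)
      _ = ∑ i ∈ B, (-c i) • g i := h1
      _ ≤ ∑ i ∈ B, c a • g i := sum_le_sum fun i _ =>
          zsmul_le_zsmul_left (hg0 i) ((neg_le_abs _).trans (hmax i))
  obtain ⟨t, ht, htB, hts⟩ := hI.exists_decomposition B g hg0 (g a) (hg0 a) hle
  let σ : (ι → ℤ) →+ (ι ⊕ ι → ℤ) :=
    { toFun := fun x => Sum.elim (fun i => if i = a then 0 else x i)
        (fun i => if c i < 0 then x i + x a else 0)
      map_zero' := by ext (i | i) <;> simp
      map_add' := fun x y => by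
        ext (i | i)
        · by_cases h : i = a <;> simp [h]
        · by_cases h : c i < 0 <;> simp [h]; ring }
  refine ⟨σ, homOfBasis (Sum.elim (fun i => g i - t i) t), ?_, ?_, ?_, ?_, ?_, ?_⟩
  · rintro x hx (i | i)
    · by_cases h : i = a <;> simp [σ, h]
      exact hx i
    · by_cases h : c i < 0 <;> simp [σ, h]
      exact add_nonneg (hx i) (hx a)
  · refine isPosHom_homOfBasis ?_
    rintro (i | i)
    · simpa using (ht i).2
    · exact (ht i).1
  · intro x
    rw [homOfBasis_apply, Fintype.sum_sum_type, addMonoidHom_apply_eq_sum θ]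
    have e1 : ∀ i, (if i = a then 0 else x i) • (g i - t i) =
        (x i • g i - x i • t i) - if i = a then x i • g i else 0 := by
      intro i
      by_cases h : i = a
      · subst h; simp [htB _ haB]
      · simp [h, smul_sub]
    have e2 : ∀ i, (if c i < 0 then x i + x a else 0) • t i = x i • t i + x a • t i := by
      intro i
      by_cases h : c i < 0
      · simp [h, add_smul]
      · simp [h, htB i (by simpa [hB] using h)]
    have e3 : ∑ i, t i = g a := by
      rw [← hts]
      exact (sum_subset (subset_univ B) fun i _ hi => htB i hi).symm
    simp only [σ, AddMonoidHom.coe_mk, ZeroHom.coe_mk, Sum.elim_inl, Sum.elim_inr, e1, e2,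
      sum_sub_distrib, sum_add_distrib, ← smul_sum, e3]
    simp [hg]
  · intro i hi
    simp [σ, hi]
  · simp [σ]
  · intro i
    by_cases h : c i < 0
    · have := neg_le_abs (c i)
      have := hmax i
      simp only [σ, AddMonoidHom.coe_mk, ZeroHom.coe_mk, Sum.elim_inr, h, if_true]
      rw [abs_lt]
      constructor <;> omega
    · simpa [σ, h] using ha

lemma killsThrough_singleton_aux [IsOrderedAddMonoid G] (hI : HasInterpolation G)
    (hU : IsUnperforated G) (M : ℕ) :
    ∀ (N : ℕ) (ι : Type) [Fintype ι] (θ : (ι → ℤ) →+ G), IsPosHom θ → ∀ c : ι → ℤ,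
      θ c = 0 → (∀ i, |c i| ≤ M) → (univ.filter fun i => |c i| = M).card ≤ N →
      KillsThrough θ {c} := by
  induction M with
  | zero =>
    intro N ι _ θ hθ c _ hM _
    refine ⟨ι, inferInstance, AddMonoidHom.id _, θ, fun x hx => hx, hθ, fun _ => rfl, ?_⟩
    rintro _ rfl
    ext i
    simpa using hM i
  | succ M ihM =>
    intro N
    induction N with
    | zero =>
      intro ι _ θ hθ c hc hM hN
      refine ihM _ ι θ hθ c hc (fun i => ?_) le_rfl
      have h1 := hM i
      have h2 : |c i| ≠ ((M + 1 : ℕ) : ℤ) := by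
        intro h
        have : i ∈ univ.filter fun i => |c i| = ((M + 1 : ℕ) : ℤ) := by simpa using h
        rw [card_eq_zero.1 (Nat.le_zero.1 hN)] at this
        simp at this
      push_cast at h1 h2
      omega
    | succ N ihN =>
      intro ι _ θ hθ c hc hM hN
      classical
      by_cases hex : ∃ a, |c a| = ((M + 1 : ℕ) : ℤ)
      swap
      · refine ihN ι θ hθ c hc hM ?_
        rw [filter_eq_empty_iff.2 fun i _ h => hex ⟨i, h⟩]
        simp
      obtain ⟨a, ha⟩ := hex
      wlog hpos : 0 < c a generalizing c
      · have hneg : KillsThrough θ {-c} := by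
          refine this (-c) (by simp [hc]) (by simpa using hM) (by simpa using hN)
            (by simpa using ha) ?_
          have : c a ≠ 0 := by
            intro h
            rw [h, abs_zero] at ha
            push_cast at ha
            omega
          simp only [Pi.neg_apply]
          omega
        obtain ⟨κ, hκ, σ, θ', h1, h2, h3, h4⟩ := hneg
        refine ⟨κ, hκ, σ, θ', h1, h2, h3, ?_⟩
        intro x hx
        rw [Set.mem_singleton_iff.1 hx]
        simpa using h4 (-c) rfl
      rw [abs_of_pos hpos] at ha
      obtain ⟨σ, θ', hσ, hθ', hcomm, h1, h2, h3⟩ :=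
        exists_reduction hI hU θ hθ c hc a hpos (by rw [ha]; exact hM)
      refine KillsThrough.comp hσ hcomm ?_
      rw [Set.image_singleton]
      refine ihN (ι ⊕ ι) θ' hθ' (σ c) (by rw [hcomm, hc]) ?_ ?_
      · rintro (i | i)
        · rcases eq_or_ne i a with rfl | h
          · rw [h2]; simp; positivity
          · rw [h1 i h]; exact hM i
        · exact (h3 i).le.trans ha.le
      · have hsub : (univ.filter fun i => |σ c i| = ((M + 1 : ℕ) : ℤ)) ⊆
            ((univ.filter fun i => |c i| = ((M + 1 : ℕ) : ℤ)).erase a).map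
              Function.Embedding.inl := by
          rintro (i | i) hi
          · rw [mem_filter] at hi
            rcases eq_or_ne i a with rfl | h
            · rw [h2] at hi
              have := hi.2
              push_cast at this
              simp at this
              omega
            · rw [h1 i h] at hi
              simpa [h] using hi.2
          · rw [mem_filter] at hi
            exact absurd hi.2 ((h3 i).trans_le ha.le).ne
        refine (card_le_card hsub).trans ?_
        rw [card_map, card_erase_of_mem (by simp [ha]; positivity)]
        omega

/-- Shen's lemma for a single relation. -/
lemma killsThrough_singleton [IsOrderedAddMonoid G] (hI : HasInterpolation G)
    (hU : IsUnperforated G) {ι : Type} [Fintype ι] (θ : (ι → ℤ) →+ G) (hθ : IsPosHom θ)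
    (c : ι → ℤ) (hc : θ c = 0) :
    KillsThrough θ {c} :=
  killsThrough_singleton_aux hI hU (∑ i, (c i).natAbs) _ ι θ hθ c hc (fun i => by
    have := single_le_sum (f := fun i => (c i).natAbs) (fun _ _ => Nat.zero_le _) (mem_univ i)
    rw [Int.abs_eq_natAbs]
    exact_mod_cast this) le_rfl

/-- Shen's lemma for finitely many relations. -/
lemma killsThrough_finset [IsOrderedAddMonoid G] (hI : HasInterpolation G)
    (hU : IsUnperforated G) (N : ℕ) :
    ∀ {ι : Type} [Fintype ι] (θ : (ι → ℤ) →+ G), IsPosHom θ → ∀ c : Finset (ι → ℤ),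
      c.card = N → (∀ x ∈ c, θ x = 0) → KillsThrough θ (c : Set (ι → ℤ)) := by
  classical
  induction N with
  | zero =>
    intro ι _ θ hθ c hN hc
    rw [card_eq_zero] at hN
    subst hN
    exact ⟨ι, inferInstance, AddMonoidHom.id _, θ, fun x hx => hx, hθ, fun _ => rfl, by simp⟩
  | succ N ih =>
    intro ι _ θ hθ c hN hc
    obtain ⟨a, s, ha, rfl, hs⟩ := card_eq_succ.1 hN
    obtain ⟨κ, _, σ, θ', hσ, hθ', hcomm, hk⟩ := ih θ hθ s hs fun x hx => hc x (by simp [hx])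
    refine KillsThrough.comp hσ hcomm ?_
    obtain ⟨μ, hμ, τ, θ'', h1, h2, h3, h4⟩ := killsThrough_singleton hI hU θ' hθ' (σ a)
      (by rw [hcomm]; exact hc a (by simp))
    refine ⟨μ, hμ, τ, θ'', h1, h2, h3, ?_⟩
    rintro _ ⟨x, hx, rfl⟩
    rcases mem_insert.1 (mem_coe.1 hx) with rfl | hx
    · exact h4 _ rfl
    · rw [hk x hx, map_zero]

/-- Shen's theorem: a positive homomorphism from a simplicial group factors positively through a
simplicial group without changing the kernel. -/
lemma killsThrough_ker [IsOrderedAddMonoid G] (hI : HasInterpolation G)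
    (hU : IsUnperforated G) {ι : Type} [Fintype ι] (θ : (ι → ℤ) →+ G) (hθ : IsPosHom θ) :
    KillsThrough θ {x | θ x = 0} := by
  obtain ⟨S, hS⟩ := IsNoetherian.noetherian (LinearMap.ker θ.toIntLinearMap)
  have hSk : ∀ x ∈ S, θ x = 0 := fun x hx => by
    have : x ∈ LinearMap.ker θ.toIntLinearMap := hS ▸ Submodule.subset_span hx
    exact LinearMap.mem_ker.1 this
  obtain ⟨κ, hκ, σ, θ', h1, h2, h3, h4⟩ := killsThrough_finset hI hU _ θ hθ S rfl hSk
  refine ⟨κ, hκ, σ, θ', h1, h2, h3, fun x hx => ?_⟩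
  have hle : LinearMap.ker θ.toIntLinearMap ≤ LinearMap.ker σ.toIntLinearMap := by
    rw [← hS, Submodule.span_le]
    intro y hy
    exact LinearMap.mem_ker.2 (h4 y hy)
  have : x ∈ LinearMap.ker θ.toIntLinearMap := LinearMap.mem_ker.2 hx
  exact LinearMap.mem_ker.1 (hle this)

lemma eq_zero_of_isPosHom {ι : Type} [Fintype ι] (h : (ι → ℤ) →+ ℤ) (hh : IsPosHom h) (w : ι → ℤ)
    (hw : ∀ i, 0 < w i) (h0 : h w = 0) (x : ι → ℤ) : h x = 0 := by
  classical
  rw [addMonoidHom_apply_eq_sum h]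
  refine sum_eq_zero fun i _ => ?_
  have h1 : 0 ≤ h (Pi.single i 1) := hh _ (by simp)
  have h2 : 0 ≤ h (w - Pi.single i 1) := hh _ fun j => by
    have := hw j
    rcases eq_or_ne j i with rfl | hj
    · simp only [Pi.sub_apply, Pi.single_eq_same, Pi.zero_apply]; omega
    · simp only [Pi.sub_apply, Pi.single_eq_of_ne hj, Pi.zero_apply]; omega
  rw [map_sub, h0] at h2
  rw [show h (Pi.single i 1) = 0 by omega, smul_zero]

/-- The inductive step of the Effros-Handelman-Shen construction in presence of a positive
endomorphism `φ`. -/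
lemma exists_simplicial_extension [IsOrderedAddMonoid G] (hI : HasInterpolation G)
    (hU : IsUnperforated G) (φ : G →+ G) (hφ : IsPosHom φ) (u : G)
    (hu : ∀ x : G, ∃ n : ℕ, x ≤ n • u) {ι : Type} [Fintype ι] (θ : (ι → ℤ) →+ G)
    (hθ : IsPosHom θ) (w : ι → ℤ) (hw : ∀ i, 0 < w i) (hwu : θ w = u) (g : G) (hg : 0 ≤ g) :
    ∃ (k : ℕ) (m q : (ι → ℤ) →+ (Fin k → ℤ)) (θ' : (Fin k → ℤ) →+ G),
      IsPosHom m ∧ IsPosHom q ∧ IsPosHom θ' ∧ (∀ x, θ' (m x) = θ x) ∧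
      (∀ x, θ' (q x) = φ (θ x)) ∧ (∀ x y, θ x + φ (θ y) = 0 → m x + q y = 0) ∧
      (∃ c, 0 ≤ c ∧ θ' c = g) ∧ ∀ j, 0 < m w j := by
  classical
  obtain ⟨N, hN⟩ := hu (φ (θ 1) + g)
  let Θ : (ι ⊕ ι ⊕ Bool → ℤ) →+ G :=
    { toFun := fun x => θ (fun i => x (.inl i)) + φ (θ (fun i => x (.inr (.inl i)))) +
        x (.inr (.inr false)) • g + x (.inr (.inr true)) • (N • u - (φ (θ 1) + g))
      map_zero' := by
        have : (fun _ : ι => (0 : ℤ)) = 0 := rfl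
        simp [this]
      map_add' := fun x y => by
        have e1 : (fun i => (x + y) (.inl i)) = (fun i => x (.inl i)) + fun i => y (.inl i) := rfl
        have e2 : (fun i => (x + y) (.inr (.inl i))) =
          (fun i => x (.inr (.inl i))) + fun i => y (.inr (.inl i)) := rfl
        rw [e1, e2]
        simp only [map_add, Pi.add_apply, add_smul]
        abel }
  have hΘ : IsPosHom Θ := fun x hx =>
    add_nonneg (add_nonneg (add_nonneg (hθ _ fun i => hx _) (hφ _ (hθ _ fun i => hx _)))
      (zsmul_nonneg hg (hx _))) (zsmul_nonneg (sub_nonneg.2 hN) (hx _))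
  obtain ⟨κ, _, σ, θ', hσ, hθ', hcomm, hker⟩ := killsThrough_ker hI hU Θ hΘ
  let A : (ι → ℤ) →+ (ι ⊕ ι ⊕ Bool → ℤ) :=
    { toFun := fun x => Sum.elim x 0
      map_zero' := by ext (i | i) <;> rfl
      map_add' := fun x y => by ext (i | i) <;> simp }
  let B : (ι → ℤ) →+ (ι ⊕ ι ⊕ Bool → ℤ) :=
    { toFun := fun x => Sum.elim 0 (Sum.elim x 0)
      map_zero' := by ext (i | i | i) <;> rfl
      map_add' := fun x y => by ext (i | i | i) <;> simp }
  have hA : IsPosHom A := by rintro x hx (i | i); exacts [hx i, le_rfl]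
  have hB : IsPosHom B := by rintro x hx (i | i | i); exacts [le_rfl, hx i, le_rfl]
  have z0 : (fun _ : ι => (0 : ℤ)) = 0 := rfl
  have hΘA : ∀ x, Θ (A x) = θ x := fun x => by simp [Θ, A, z0]
  have hΘB : ∀ x, Θ (B x) = φ (θ x) := fun x => by simp [Θ, B, z0]
  let e0 : ι ⊕ ι ⊕ Bool → ℤ := Pi.single (.inr (.inr false)) 1
  let e1 : ι ⊕ ι ⊕ Bool → ℤ := Pi.single (.inr (.inr true)) 1
  have he0 : Θ e0 = g := by simp [Θ, e0, z0]
  have he1 : Θ e1 = N • u - (φ (θ 1) + g) := by simp [Θ, e1, z0]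
  have hrel : N • σ (A w) = σ (B 1) + σ e0 + σ e1 := by
    rw [← map_nsmul, ← map_add, ← map_add, ← sub_eq_zero, ← map_sub]
    refine hker _ ?_
    simp only [Set.mem_ofPred_eq, map_sub, map_add, map_nsmul, hΘA, hΘB, he0, he1, hwu]
    abel
  have hpos0 : 0 ≤ σ (A w) := hσ _ (hA _ fun i => (hw i).le)
  have hA0 : ∀ j, σ (A w) j = 0 → ∀ x, σ (A x) j = 0 := by
    intro j hj
    exact eq_zero_of_isPosHom (((Pi.evalAddMonoidHom (fun _ => ℤ) j).comp σ).comp A)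
      (fun x hx => hσ _ (hA _ hx) j) w hw hj
  have hsplit : ∀ j, σ (A w) j = 0 → σ (B 1) j = 0 ∧ σ e0 j = 0 := by
    intro j hj
    have h := congrFun hrel j
    simp only [Pi.smul_apply, Pi.add_apply, hj, smul_zero] at h
    have b1 : 0 ≤ σ (B 1) j := hσ _ (hB _ fun _ => zero_le_one) j
    have b2 : 0 ≤ σ e0 j := hσ _ (by simp [e0]) j
    have b3 : 0 ≤ σ e1 j := hσ _ (by simp [e1]) j
    omega
  have hB0 : ∀ j, σ (A w) j = 0 → ∀ x, σ (B x) j = 0 := by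
    intro j hj
    exact eq_zero_of_isPosHom (((Pi.evalAddMonoidHom (fun _ => ℤ) j).comp σ).comp B)
      (fun x hx => hσ _ (hB _ hx) j) 1 (fun _ => one_pos) (hsplit j hj).1
  let J := {j : κ // σ (A w) j ≠ 0}
  let ε : J ≃ Fin (Fintype.card J) := Fintype.equivFin J
  let ρ : (κ → ℤ) →+ (Fin (Fintype.card J) → ℤ) :=
    { toFun := fun y i => y (ε.symm i).1
      map_zero' := rfl
      map_add' := fun _ _ => rfl }
  let η : (Fin (Fintype.card J) → ℤ) →+ (κ → ℤ) :=
    { toFun := fun z j => if h : σ (A w) j ≠ 0 then z (ε ⟨j, h⟩) else 0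
      map_zero' := by ext j; simp
      map_add' := fun x y => by
        ext j
        by_cases h : σ (A w) j = 0 <;> simp [h] }
  have hηρ : ∀ y, (∀ j, σ (A w) j = 0 → y j = 0) → η (ρ y) = y := by
    intro y hy
    ext j
    by_cases h : σ (A w) j = 0
    · simp [η, h, hy j h]
    · simp [η, ρ, h]
  refine ⟨Fintype.card J, ρ.comp (σ.comp A), ρ.comp (σ.comp B), θ'.comp η,
    fun x hx i => hσ _ (hA _ hx) _, fun x hx i => hσ _ (hB _ hx) _, fun z hz => ?_, fun x => ?_,
    fun x => ?_, fun x y hxy => ?_, ⟨ρ (σ e0), fun i => hσ _ (by simp [e0]) _, ?_⟩, fun j => ?_⟩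
  · refine hθ' _ fun j => ?_
    by_cases h : σ (A w) j = 0
    · simp [η, h]
    · simpa [η, h] using hz _
  · simp only [AddMonoidHom.comp_apply]
    rw [hηρ _ fun j hj => hA0 j hj x, hcomm, hΘA]
  · simp only [AddMonoidHom.comp_apply]
    rw [hηρ _ fun j hj => hB0 j hj x, hcomm, hΘB]
  · simp only [AddMonoidHom.comp_apply]
    rw [← map_add, ← map_add, hker (A x + B y), map_zero]
    simpa [hΘA, hΘB] using hxy
  · simp only [AddMonoidHom.comp_apply]
    rw [hηρ _ fun j hj => (hsplit j hj).2, hcomm, he0]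
  · exact lt_of_le_of_ne (hpos0 _) (Ne.symm (ε.symm j).2)

end Algebra

section Selection

lemma exists_measurable_selection {X Z : Type} [MeasurableSpace X] [MeasurableSpace Z]
    [Countable Z] [Nonempty Z] (R : X → Z → Prop) (hR : ∀ z, MeasurableSet {x | R x z}) :
    ∃ S : X → Z, Measurable S ∧ ∀ x, (∃ z, R x z) → R x (S x) := by
  classical
  obtain ⟨z, hz⟩ := exists_surjective_nat Z
  let p : X → ℕ → Prop := fun x n => R x (z n) ∨ ¬ ∃ m, R x (z m)
  have hp : ∀ x, ∃ n, p x n := fun x => by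
    by_cases h : ∃ m, R x (z m)
    · exact h.imp fun n hn => Or.inl hn
    · exact ⟨0, Or.inr h⟩
  have hpm : ∀ n, MeasurableSet {x | p x n} := fun n => by
    have : MeasurableSet {x | ∃ m, R x (z m)} := by
      simp only [Set.ofPred_exists]
      exact MeasurableSet.iUnion fun m => hR _
    exact (hR _).union this.compl
  refine ⟨fun x => z (Nat.find (hp x)), measurable_from_nat.comp (measurable_find hp hpm), ?_⟩
  rintro x ⟨y, hy⟩
  obtain ⟨m, rfl⟩ := hz y
  exact (Nat.find_spec (hp x)).resolve_right fun h => h ⟨m, hy⟩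

/-- A measurable form of dependent choice with values in a countable set. -/
lemma exists_measurable_seq {X Z : Type} [MeasurableSpace X] [MeasurableSpace Z]
    [DiscreteMeasurableSpace Z] [Countable Z] [Nonempty Z]
    (R₀ : X → Z → Prop) (hR₀ : ∀ z, MeasurableSet {x | R₀ x z})
    (R : ℕ → X → Z → Z → Prop) (hR : ∀ n s t, MeasurableSet {x | R n x s t}) :
    ∃ S : ℕ → X → Z, (∀ n, Measurable (S n)) ∧ (∀ x, (∃ z, R₀ x z) → R₀ x (S 0 x)) ∧
      ∀ n x, (∃ z, R n x (S n x) z) → R n x (S n x) (S (n + 1) x) := by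
  obtain ⟨S₀, hS₀, h₀⟩ := exists_measurable_selection R₀ hR₀
  have step : ∀ (n : ℕ) (S : {S : X → Z // Measurable S}), ∃ T : {T : X → Z // Measurable T},
      ∀ x, (∃ z, R n x (S.1 x) z) → R n x (S.1 x) (T.1 x) := by
    rintro n ⟨S, hS⟩
    obtain ⟨T, hT, h⟩ := exists_measurable_selection (fun x z => R n x (S x) z) fun z => by
      have : {x | R n x (S x) z} = ⋃ s, S ⁻¹' {s} ∩ {x | R n x s z} := by
        ext x
        simp
      rw [this]
      exact MeasurableSet.iUnion fun s => (hS (measurableSet_singleton s)).inter (hR n s z)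
    exact ⟨⟨T, hT⟩, h⟩
  choose next hnext using step
  let S : ℕ → {S : X → Z // Measurable S} := fun n => Nat.rec ⟨S₀, hS₀⟩ next n
  exact ⟨fun n => (S n).1, fun n => (S n).2, h₀, fun n => hnext n (S n)⟩

end Selection

section Stages

/-- The sum `Σ_{i<k} c_i • θ_i` in the group coded by `f` with identity `e`. -/
def codeSum (f : ℕ × ℕ → ℕ) (e : ℕ) (θ c : ℕ → ℕ) : ℕ → ℕ
  | 0 => e
  | k + 1 => f (codeSum f e θ c k, codeSmul f e (θ k) (c k))

/-- The space in which dimension groups with an endomorphism are coded. -/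
abbrev EndSpace : Type := ((ℕ × ℕ → ℕ) × (ℕ → Bool) × ℕ) × (ℕ → ℕ)

/-- One level of a Bratteli diagram mapping to a coded group with identity `e`: the number `l` of
vertices, the weights `w`, the images `θ` of the standard basis vectors, and the matrices `m` and
`q` from the previous level. -/
structure Stage where
  e : ℕ
  l : ℕ
  w : ℕ →₀ ℕ
  θ : ℕ →₀ ℕ
  m : ℕ × ℕ →₀ ℕ
  q : ℕ × ℕ →₀ ℕ

instance : Countable Stage :=
  Function.Injective.countable
    (f := fun s : Stage => (s.e, s.l, s.w, s.θ, s.m, s.q)) fun s t h => by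
      cases s; cases t; simpa using h

instance : Nonempty Stage := ⟨⟨0, 0, 0, 0, 0, 0⟩⟩

instance : MeasurableSpace Stage := ⊤

/-- The level `s` is compatible with the cone and order unit coded by `x`. -/
def IsStage (x : EndSpace) (s : Stage) : Prop :=
  IsIdentityOf x.1.1 s.e ∧ (∀ i, 0 < s.w i ↔ i < s.l) ∧
    (∀ i, i < s.l → x.1.2.1 (s.θ i) = true) ∧ codeSum x.1.1 s.e s.θ s.w s.l = x.1.2.2

/-- `s` is an admissible initial level. -/
def IsInitialStage (x : EndSpace) (s : Stage) : Prop :=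
  IsStage x s ∧ s.l = 1 ∧ s.w 0 = 1

/-- `t` is an admissible level to follow `s`, with `n` in the image of its cone if `n` is
positive. -/
def IsNextStage (n : ℕ) (x : EndSpace) (s t : Stage) : Prop :=
  IsStage x t ∧ t.e = s.e ∧
    (∀ i j, s.l ≤ i ∨ t.l ≤ j → t.m (i, j) = 0) ∧
    (∀ j, j < t.l → t.w j = ∑ i ∈ range s.l, t.m (i, j) * s.w i) ∧
    (∀ i, i < s.l → codeSum x.1.1 t.e t.θ (fun j => t.m (i, j)) t.l = s.θ i) ∧
    (∀ i, i < s.l → codeSum x.1.1 t.e t.θ (fun j => t.q (i, j)) t.l = x.2 (s.θ i)) ∧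
    (∀ a b a' b' : ℕ →₀ ℕ,
      x.1.1 (codeSum x.1.1 s.e s.θ a s.l, x.2 (codeSum x.1.1 s.e s.θ b s.l)) =
        x.1.1 (codeSum x.1.1 s.e s.θ a' s.l, x.2 (codeSum x.1.1 s.e s.θ b' s.l)) →
      ∀ j, j < t.l → ∑ i ∈ range s.l, (t.m (i, j) * a i + t.q (i, j) * b i) =
        ∑ i ∈ range s.l, (t.m (i, j) * a' i + t.q (i, j) * b' i)) ∧
    (x.1.2.1 n = true → ∃ c : ℕ →₀ ℕ, codeSum x.1.1 t.e t.θ c t.l = n)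

lemma measurable_apply_apply {X I J : Type} [MeasurableSpace X] [MeasurableSpace I]
    [MeasurableSpace J] [Countable I] [MeasurableSingletonClass I] [DiscreteMeasurableSpace J]
    [Countable J]
    {F : X → I → J} {g : X → I} (hF : Measurable F) (hg : Measurable g) :
    Measurable fun x => F x (g x) := by
  refine measurable_to_countable' fun c => ?_
  have : (fun x => F x (g x)) ⁻¹' {c} = ⋃ i, g ⁻¹' {i} ∩ (fun x => F x i) ⁻¹' {c} := by
    ext x
    simp
  rw [this]
  exact MeasurableSet.iUnion fun i => (hg (measurableSet_singleton i)).inter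
    ((measurable_pi_iff.1 hF i) (measurableSet_singleton c))

lemma measurable_codeSmul (e a n : ℕ) :
    Measurable fun x : EndSpace => codeSmul x.1.1 e a n := by
  induction n with
  | zero => exact measurable_const
  | succ n ih =>
    exact measurable_apply_apply (F := fun x : EndSpace => x.1.1) (by fun_prop)
      (measurable_const.prodMk ih)

lemma measurable_codeSum (e : ℕ) (θ c : ℕ → ℕ) (k : ℕ) :
    Measurable fun x : EndSpace => codeSum x.1.1 e θ c k := by
  induction k with
  | zero => exact measurable_const
  | succ n ih =>
    exact measurable_apply_apply (F := fun x : EndSpace => x.1.1) (by fun_prop)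
      (ih.prodMk (measurable_codeSmul e _ _))

lemma measurable_eq_of_countable {X : Type} [MeasurableSpace X] {J : Type} [MeasurableSpace J]
    [Countable J] [DiscreteMeasurableSpace J] {g h : X → J} (hg : Measurable g)
    (hh : Measurable h) : Measurable fun x => g x = h x :=
  measurableSet_setOfPred.1 (measurableSet_eq_fun hg hh)

lemma measurable_isStage (s : Stage) : Measurable fun x => IsStage x s := by
  unfold IsStage IsIdentityOf
  refine .and (.forall fun a => .and ?_ ?_) (.and measurable_const
    (.and (.forall fun i => .imp measurable_const ?_) ?_))
  · exact measurable_eq_of_countable (by fun_prop) measurable_const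
  · exact measurable_eq_of_countable (by fun_prop) measurable_const
  · exact measurable_eq_of_countable (by fun_prop) measurable_const
  · exact measurable_eq_of_countable (measurable_codeSum _ _ _ _) (by fun_prop)

lemma measurable_isNextStage (n : ℕ) (s t : Stage) :
    Measurable fun x => IsNextStage n x s t := by
  unfold IsNextStage
  have key (a b : ℕ → ℕ) : Measurable fun x : EndSpace =>
      x.1.1 (codeSum x.1.1 s.e s.θ a s.l, x.2 (codeSum x.1.1 s.e s.θ b s.l)) :=
    measurable_apply_apply (F := fun x : EndSpace => x.1.1) (by fun_prop)
      ((measurable_codeSum _ _ _ _).prodMk (measurable_apply_apply (by fun_prop)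
        (measurable_codeSum _ _ _ _)))
  refine .and (measurable_isStage t) (.and measurable_const (.and measurable_const
    (.and measurable_const (.and (.forall fun i => .imp measurable_const ?_)
    (.and (.forall fun i => .imp measurable_const ?_)
    (.and (.forall fun a => .forall fun b => .forall fun a' => .forall fun b' =>
      .imp ?_ measurable_const) (.imp ?_ (.exists fun c => ?_))))))))
  · exact measurable_eq_of_countable (measurable_codeSum _ _ _ _) measurable_const
  · exact measurable_eq_of_countable (measurable_codeSum _ _ _ _) (by fun_prop)
  · exact measurable_eq_of_countable (key a b) (key a' b')
  · exact measurable_eq_of_countable (by fun_prop) measurable_const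
  · exact measurable_eq_of_countable (measurable_codeSum _ _ _ _) measurable_const

/-- There is a Borel assignment of sequences of levels. -/
lemma exists_measurable_stages : ∃ S : ℕ → EndSpace → Stage, (∀ n, Measurable (S n)) ∧
    (∀ x, (∃ s, IsInitialStage x s) → IsInitialStage x (S 0 x)) ∧
    ∀ n x, (∃ t, IsNextStage n x (S n x) t) → IsNextStage n x (S n x) (S (n + 1) x) :=
  exists_measurable_seq IsInitialStage
    (fun s => measurableSet_setOfPred.2 ((measurable_isStage s).and measurable_const))
    IsNextStage fun n s t => measurableSet_setOfPred.2 (measurable_isNextStage n s t)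

end Stages

section Coding

/-- `ε` identifies the coded ordered group with endomorphism `x` with the ordered group `G` with
endomorphism `φ`. -/
structure IsCoding (x : EndSpace) {G : Type} [AddCommGroup G] [PartialOrder G]
    (ε : ℕ ≃ G) (φ : G →+ G) : Prop where
  map_add : ∀ a b, ε (x.1.1 (a, b)) = ε a + ε b
  pos_iff : ∀ a, x.1.2.1 a = true ↔ 0 ≤ ε a
  map_endo : ∀ a, ε (x.2 a) = φ (ε a)

/-- The carrier of a coded group. -/
def CodeCarrier : Type := ℕ

lemma exists_coding (x : EndSpace) (hx : x ∈ EndDGCode) :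
    ∃ (G : Type) (_ : AddCommGroup G) (_ : PartialOrder G) (_ : IsOrderedAddMonoid G)
      (ε : ℕ ≃ G) (φ : G →+ G), IsCoding x ε φ ∧ HasInterpolation G ∧ IsUnperforated G ∧
        IsPosHom φ ∧ (∀ g, ∃ n : ℕ, g ≤ n • ε x.1.2.2) ∧ 0 ≤ ε x.1.2.2 ∧
        ∀ g : G, ∃ a b, 0 ≤ a ∧ 0 ≤ b ∧ g + b = a := by
  obtain ⟨⟨⟨f, P, u⟩, φ⟩, rfl⟩ : ∃ y : EndSpace, y = x := ⟨x, rfl⟩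
  obtain ⟨⟨⟨hassoc, e, he, hinv⟩, hcomm, hadd, hrest⟩, hhom, hpos⟩ := hx
  simp only at *
  obtain ⟨hPe, hanti, hdir, hunp, hriesz, hPu, hunit⟩ := hrest e he
  choose ng hng using hinv
  let ε : ℕ ≃ CodeCarrier := Equiv.refl ℕ
  let : Add CodeCarrier := ⟨fun a b => ε (f (ε.symm a, ε.symm b))⟩
  let : Zero CodeCarrier := ⟨ε e⟩
  let : Neg CodeCarrier := ⟨fun a => ε (ng (ε.symm a))⟩
  let grp : AddCommGroup CodeCarrier :=
    { add_assoc := fun a b c => hassoc a b c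
      zero_add := fun a => (he a).1
      add_zero := fun a => (he a).2
      neg_add_cancel := fun a => (hng a).2
      add_comm := fun a b => hcomm a b
      nsmul := nsmulRec
      zsmul := zsmulRec }
  have hε : ∀ a b, ε (f (a, b)) = ε a + ε b := fun _ _ => rfl
  have hε0 : ε e = 0 := rfl
  have hle : ∀ a b, codeLe f P a b ↔ P (ε.symm (ε b - ε a)) = true := by
    intro a b
    constructor
    · rintro ⟨d, hd, rfl⟩
      rw [hε, add_sub_cancel_left]
      simpa using hd
    · intro h
      refine ⟨_, h, ε.injective ?_⟩
      rw [hε]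
      simp
  let ord : PartialOrder CodeCarrier :=
    { le := fun a b => codeLe f P (ε.symm a) (ε.symm b)
      le_refl := fun a => ⟨e, hPe, (he _).2⟩
      le_trans := by
        rintro a b c ⟨d, hd, hab⟩ ⟨d', hd', hbc⟩
        exact ⟨f (d, d'), hadd _ _ hd hd', by rw [← hassoc, hab, hbc]⟩
      le_antisymm := by
        rintro a b ⟨d, hd, hab⟩ ⟨d', hd', hba⟩
        have h1 : a + ε d = b := hab
        have h2 : b + ε d' = a := hba
        have h3 : ε d + ε d' = 0 := by
          have : a + (ε d + ε d') = a := by rw [← add_assoc, h1, h2]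
          simpa using this
        have h5 : d = e := hanti d d' hd hd' h3
        rw [← h1, h5, hε0, add_zero] }
  have hle' : ∀ a b : ℕ, ε a ≤ ε b ↔ codeLe f P a b := fun _ _ => Iff.rfl
  have hP : ∀ a, P a = true ↔ 0 ≤ ε a := fun a => by
    rw [← hε0, hle', hle, hε0, sub_zero, Equiv.symm_apply_apply]
  have hoa : IsOrderedAddMonoid CodeCarrier :=
    { add_le_add_left := fun a b hab c => by
        obtain ⟨a, rfl⟩ := ε.surjective a
        obtain ⟨b, rfl⟩ := ε.surjective b
        obtain ⟨c, rfl⟩ := ε.surjective c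
        rw [hle', hle] at hab
        rw [← hε, ← hε, hle', hle, hε, hε]
        simpa using hab }
  have hsmul : ∀ a n, ε (codeSmul f e a n) = n • ε a := by
    intro a n
    induction n with
    | zero => rw [zero_smul]; rfl
    | succ n ih => rw [succ_nsmul', ← ih]; rfl
  refine ⟨CodeCarrier, grp, ord, hoa, ε, AddMonoidHom.mk' (fun a => ε (φ (ε.symm a)))
    (fun a b => hhom a b), ⟨hε, hP, fun _ => rfl⟩, fun x₀ x₁ y₀ y₁ => hriesz x₀ x₁ y₀ y₁, ?_, ?_,
    ?_, (hP u).1 hPu, ?_⟩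
  · intro a n hn h
    obtain ⟨a, rfl⟩ := ε.surjective a
    rw [← hsmul, ← hP] at h
    exact (hP a).1 (hunp a n hn h)
  · intro a h
    exact (hP _).1 (hpos _ ((hP _).2 h))
  · intro g
    obtain ⟨n, hn, -⟩ := hunit g
    exact ⟨n, by rw [← hsmul]; exact hn⟩
  · intro g
    obtain ⟨a, b, ha, hb, hab⟩ := hdir g
    exact ⟨a, b, (hP a).1 ha, (hP b).1 hb, hab⟩

variable {x : EndSpace} {G : Type} [AddCommGroup G] [PartialOrder G] {ε : ℕ ≃ G} {φ : G →+ G}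

lemma IsCoding.map_identity (h : IsCoding x ε φ) {e : ℕ} (he : IsIdentityOf x.1.1 e) :
    ε e = 0 := by
  have := h.map_add e e
  rw [(he e).1] at this
  simpa using this

lemma IsCoding.map_codeSmul (h : IsCoding x ε φ) {e : ℕ} (he : ε e = 0) (a n : ℕ) :
    ε (codeSmul x.1.1 e a n) = n • ε a := by
  induction n with
  | zero => simpa [codeSmul] using he
  | succ n ih => rw [codeSmul, h.map_add, ih, succ_nsmul']

lemma IsCoding.map_codeSum (h : IsCoding x ε φ) {e : ℕ} (he : ε e = 0) (θ c : ℕ → ℕ) (k : ℕ) :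
    ε (codeSum x.1.1 e θ c k) = ∑ i ∈ range k, c i • ε (θ i) := by
  induction k with
  | zero => simpa [codeSum] using he
  | succ n ih => rw [codeSum, h.map_add, ih, h.map_codeSmul he, sum_range_succ]

/-- Extension by zero of a finite vector. -/
noncomputable def extendVec {k : ℕ} (v : Fin k → ℕ) : ℕ →₀ ℕ :=
  Finsupp.onFinset (range k) (fun i => if h : i < k then v ⟨i, h⟩ else 0) fun i hi => by
    by_contra h
    simp only [mem_range] at h
    simp [h] at hi

@[simp] lemma extendVec_coe {k : ℕ} (v : Fin k → ℕ) (i : Fin k) : extendVec v i = v i := by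
  simp [extendVec]

lemma extendVec_of_le {k : ℕ} (v : Fin k → ℕ) {i : ℕ} (hi : k ≤ i) : extendVec v i = 0 := by
  simp [extendVec, hi]

/-- Extension by zero of a finite matrix. -/
noncomputable def extendMat {k l : ℕ} (v : Fin k → Fin l → ℕ) : ℕ × ℕ →₀ ℕ :=
  Finsupp.onFinset (range k ×ˢ range l)
    (fun p => if h : p.1 < k ∧ p.2 < l then v ⟨p.1, h.1⟩ ⟨p.2, h.2⟩ else 0) fun p hp => by
      by_contra h
      simp only [mem_product, mem_range] at h
      simp [h] at hp

@[simp] lemma extendMat_coe {k l : ℕ} (v : Fin k → Fin l → ℕ) (i : Fin k) (j : Fin l) :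
    extendMat v ((i : ℕ), (j : ℕ)) = v i j := by
  simp [extendMat]

lemma extendMat_of_le {k l : ℕ} (v : Fin k → Fin l → ℕ) {i j : ℕ} (h : k ≤ i ∨ l ≤ j) :
    extendMat v (i, j) = 0 := by
  have : ¬ (i < k ∧ j < l) := by omega
  simp [extendMat, this]

lemma exists_isInitialStage (h : IsCoding x ε φ) (hu : 0 ≤ ε x.1.2.2) {e : ℕ}
    (he : IsIdentityOf x.1.1 e) : ∃ s, IsInitialStage x s := by
  refine ⟨⟨e, 1, Finsupp.single 0 1, Finsupp.single 0 x.1.2.2, 0, 0⟩,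
    ⟨he, fun i => ?_, fun i hi => ?_, ?_⟩, rfl, by simp⟩
  · rcases eq_or_ne i 0 with rfl | hi
    · simp
    · simp [hi]
  · obtain rfl : i = 0 := by simpa using hi
    simpa [h.pos_iff] using hu
  · apply ε.injective
    rw [h.map_codeSum (h.map_identity he)]
    simp

lemma exists_isNextStage [IsOrderedAddMonoid G] (h : IsCoding x ε φ) (hI : HasInterpolation G)
    (hU : IsUnperforated G) (hφ : IsPosHom φ) (hu : ∀ g, ∃ n : ℕ, g ≤ n • ε x.1.2.2) (n : ℕ)
    (s : Stage) (hs : IsStage x s) : ∃ t, IsNextStage n x s t := by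
  classical
  obtain ⟨he, hw, hθ, hwu⟩ := hs
  have he0 := h.map_identity he
  set θ : (Fin s.l → ℤ) →+ G := homOfBasis fun i => ε (s.θ i) with hθdef
  have hθ0 : IsPosHom θ := isPosHom_homOfBasis fun i => (h.pos_iff _).1 (hθ i i.2)
  have hsum : ∀ c : ℕ → ℕ, ε (codeSum x.1.1 s.e s.θ c s.l) = θ fun i => (c i : ℤ) := by
    intro c
    rw [h.map_codeSum he0, sum_range, hθdef, homOfBasis_apply]
    simp
  obtain ⟨g, hg0, hg⟩ : ∃ g : G, 0 ≤ g ∧ (0 ≤ ε n → g = ε n) := by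
    by_cases hn : 0 ≤ ε n
    · exact ⟨ε n, hn, fun _ => rfl⟩
    · exact ⟨0, le_rfl, fun h => absurd h hn⟩
  obtain ⟨k, m, q, θ', hm, hq, hθ', hθm, hθq, hker, ⟨c, hc0, hc⟩, hpos⟩ :=
    exists_simplicial_extension hI hU φ hφ (ε x.1.2.2) hu θ hθ0 (fun i => (s.w i : ℤ))
      (fun i => by exact_mod_cast (hw i).2 i.2) (by rw [← hsum, hwu]) g hg0
  have hsingle : ∀ {a : ℕ} (i : Fin a), (0 : Fin a → ℤ) ≤ Pi.single i 1 := fun i => by simp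
  let t : Stage :=
    { e := s.e
      l := k
      w := extendVec fun j => (m (fun i => (s.w i : ℤ)) j).toNat
      θ := extendVec fun j => ε.symm (θ' (Pi.single j 1))
      m := extendMat fun i j => (m (Pi.single i 1) j).toNat
      q := extendMat fun i j => (q (Pi.single i 1) j).toNat }
  have hmt : ∀ i j, (t.m ((i : Fin s.l), (j : Fin k)) : ℤ) = m (Pi.single i 1) j := fun i j => by
    simp only [t, extendMat_coe]
    exact Int.toNat_of_nonneg (hm _ (hsingle i) j)
  have hqt : ∀ i j, (t.q ((i : Fin s.l), (j : Fin k)) : ℤ) = q (Pi.single i 1) j := fun i j => by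
    simp only [t, extendMat_coe]
    exact Int.toNat_of_nonneg (hq _ (hsingle i) j)
  have hwt : ∀ j : Fin k, (t.w j : ℤ) = m (fun i => (s.w i : ℤ)) j := fun j => by
    simp only [t, extendVec_coe]
    exact Int.toNat_of_nonneg (hpos j).le
  have hsumt : ∀ c : ℕ → ℕ, ε (codeSum x.1.1 t.e t.θ c t.l) =
      θ' fun i : Fin k => (c i : ℤ) := by
    intro c
    rw [h.map_codeSum he0, sum_range, addMonoidHom_apply_eq_sum θ']
    refine sum_congr rfl fun j _ => ?_
    simp [t]
  have hmv : ∀ (v : Fin s.l → ℤ) (j : Fin k), m v j = ∑ i, v i * t.m ((i : ℕ), (j : ℕ)) := by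
    intro v j
    rw [addMonoidHom_apply_eq_sum m, Finset.sum_apply]
    exact sum_congr rfl fun i _ => by rw [hmt]; simp
  have hqv : ∀ (v : Fin s.l → ℤ) (j : Fin k), q v j = ∑ i, v i * t.q ((i : ℕ), (j : ℕ)) := by
    intro v j
    rw [addMonoidHom_apply_eq_sum q, Finset.sum_apply]
    exact sum_congr rfl fun i _ => by rw [hqt]; simp
  have hwsum : ∀ j, j < k → t.w j = ∑ i ∈ range s.l, t.m (i, j) * s.w i := by
    intro j hj
    have h1 := hwt ⟨j, hj⟩
    rw [hmv] at h1
    rw [sum_range]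
    zify
    rw [h1]
    exact sum_congr rfl fun i _ => mul_comm _ _
  refine ⟨t, ⟨he, fun j => ⟨fun hj => ?_, fun hj => ?_⟩, fun j hj => ?_, ?_⟩, rfl,
    fun i j hij => extendMat_of_le (fun i j => (m (Pi.single i 1) j).toNat) hij,
    hwsum, fun i hi => ?_, fun i hi => ?_,
    fun a b a' b' hab j hj => ?_, fun hn => ?_⟩
  · by_contra hk
    rw [show t.w j = 0 by simp only [t]; exact extendVec_of_le _ (not_lt.1 hk)] at hj
    exact lt_irrefl _ hj
  · have := hpos ⟨j, hj⟩
    rw [← hwt] at this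
    exact_mod_cast this
  · have htθ : t.θ j = ε.symm (θ' (Pi.single ⟨j, hj⟩ 1)) := by
      simp only [t]
      exact extendVec_coe _ ⟨j, hj⟩
    rw [h.pos_iff, htθ, Equiv.apply_symm_apply]
    exact hθ' _ (hsingle _)
  · apply ε.injective
    rw [hsumt, ← hwu, hsum, ← hθm]
    exact congrArg θ' (funext hwt)
  · apply ε.injective
    rw [hsumt, show (fun j : Fin k => (t.m (i, j) : ℤ)) = m (Pi.single ⟨i, hi⟩ 1) from
      funext fun j => hmt ⟨i, hi⟩ j, hθm, hθdef, homOfBasis_apply]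
    simp [Pi.single_apply]
  · apply ε.injective
    rw [hsumt, show (fun j : Fin k => (t.q (i, j) : ℤ)) = q (Pi.single ⟨i, hi⟩ 1) from
      funext fun j => hqt ⟨i, hi⟩ j, hθq, hθdef, homOfBasis_apply, h.map_endo]
    simp [Pi.single_apply]
  · have h1 := congrArg ε hab
    simp only [h.map_add, h.map_endo, hsum] at h1
    have h2 := hker ((fun i : Fin s.l => (a i : ℤ)) - fun i : Fin s.l => (a' i : ℤ))
      ((fun i : Fin s.l => (b i : ℤ)) - fun i : Fin s.l => (b' i : ℤ)) (by
        simp only [map_sub]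
        rw [← sub_eq_zero] at h1
        rw [← h1]
        abel)
    have h3 := congrFun h2 ⟨j, hj⟩
    rw [Pi.add_apply, hmv, hqv] at h3
    rw [sum_range, sum_range]
    zify
    rw [← sub_eq_zero, ← sum_sub_distrib]
    rw [← sum_add_distrib] at h3
    rw [← Pi.zero_apply (M := fun _ => ℤ) (⟨j, hj⟩ : Fin k), ← h3]
    refine sum_congr rfl fun i _ => ?_
    simp only [Pi.sub_apply]
    ring
  · refine ⟨extendVec fun j => (c j).toNat, ε.injective ?_⟩
    rw [hsumt, ← hg ((h.pos_iff n).1 hn), ← hc]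
    congr 1
    ext j
    rw [extendVec_coe]
    exact Int.toNat_of_nonneg (hc0 j)

end Coding

section Limit

variable {x : EndSpace} {G : Type} [AddCommGroup G] {ε : ℕ ≃ G} {φ : G →+ G}

/-- A sequence of levels each of which is admissible after the preceding one. -/
def IsStageSeq (x : EndSpace) (s : ℕ → Stage) : Prop :=
  IsInitialStage x (s 0) ∧ ∀ n, IsNextStage n x (s n) (s (n + 1))

lemma IsStageSeq.isStage {s : ℕ → Stage} (hs : IsStageSeq x s) : ∀ n, IsStage x (s n)
  | 0 => hs.1.1
  | n + 1 => (hs.2 n).1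

/-- The map `ℤ^l → G` given by a level. -/
def levelMap (ε : ℕ ≃ G) (s : Stage) (y : ℕ → ℤ) : G :=
  ∑ i ∈ range s.l, y i • ε (s.θ i)

/-- The levels of a sequence of stages. -/
abbrev levels (s : ℕ → Stage) (n : ℕ) : ℕ := (s n).l

/-- The connecting matrices of a sequence of stages. -/
abbrev connMats (s : ℕ → Stage) (n : ℕ) (p : ℕ × ℕ) : ℕ := (s (n + 1)).m p

/-- The endomorphism matrices of a sequence of stages. -/
abbrev endoMats (s : ℕ → Stage) (n : ℕ) (p : ℕ × ℕ) : ℕ := (s (n + 1)).q p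

lemma levelMap_add (s : Stage) (y z : ℕ → ℤ) :
    levelMap ε s (fun i => y i + z i) = levelMap ε s y + levelMap ε s z := by
  simp [levelMap, add_smul, sum_add_distrib]

lemma levelMap_sub (s : Stage) (y z : ℕ → ℤ) :
    levelMap ε s (fun i => y i - z i) = levelMap ε s y - levelMap ε s z := by
  simp [levelMap, sub_smul, sum_sub_distrib]

lemma IsCoding.map_codeSum_eq_levelMap [PartialOrder G] (h : IsCoding x ε φ) {s : Stage}
    (hs : IsStage x s) (c : ℕ → ℕ) :
    ε (codeSum x.1.1 s.e s.θ c s.l) = levelMap ε s fun i => (c i : ℤ) := by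
  rw [h.map_codeSum (h.map_identity hs.1), levelMap]
  simp

/-- Multiplication by a matrix is compatible with the maps to `G` if it is so on the standard
basis. -/
lemma levelMap_mul (M : ℕ × ℕ → ℕ) (s t : Stage) (y : ℕ → ℤ) (γ : ℕ → G)
    (hM : ∀ i < s.l, levelMap ε t (fun j => (M (i, j) : ℤ)) = γ i) :
    levelMap ε t (fun j => if j < t.l then ∑ i ∈ range s.l, (M (i, j) : ℤ) * y i else 0) =
      ∑ i ∈ range s.l, y i • γ i := by
  have h1 : levelMap ε t (fun j => if j < t.l then ∑ i ∈ range s.l, (M (i, j) : ℤ) * y i else 0) =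
      ∑ j ∈ range t.l, ∑ i ∈ range s.l, ((M (i, j) : ℤ) * y i) • ε (t.θ j) := by
    refine sum_congr rfl fun j hj => ?_
    simp only [if_pos (mem_range.1 hj), sum_smul]
  rw [h1, sum_comm]
  refine sum_congr rfl fun i hi => ?_
  rw [← hM i (mem_range.1 hi), levelMap, smul_sum]
  exact sum_congr rfl fun j _ => by rw [mul_comm, mul_smul]

variable [PartialOrder G] {s : ℕ → Stage}

lemma levelMap_stepMap (h : IsCoding x ε φ) (hs : IsStageSeq x s) (n : ℕ) (y : ℕ → ℤ) :
    levelMap ε (s (n + 1)) (stepMap (levels s) (connMats s) n y) = levelMap ε (s n) y := by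
  refine levelMap_mul (s (n + 1)).m (s n) (s (n + 1)) y _ fun i hi => ?_
  rw [← h.map_codeSum_eq_levelMap (hs.isStage _), (hs.2 n).2.2.2.2.1 i hi]

lemma levelMap_qStep (h : IsCoding x ε φ) (hs : IsStageSeq x s) (n : ℕ) (y : ℕ → ℤ) :
    levelMap ε (s (n + 1)) (qStep (levels s) (endoMats s) n y) = φ (levelMap ε (s n) y) := by
  refine (levelMap_mul (s (n + 1)).q (s n) (s (n + 1)) y (fun i => φ (ε ((s n).θ i)))
    fun i hi => ?_).trans ?_
  · rw [← h.map_codeSum_eq_levelMap (hs.isStage _), (hs.2 n).2.2.2.2.2.1 i hi, h.map_endo]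
  · simp [levelMap]

lemma suppLt_stepMap (n : ℕ) (y : ℕ → ℤ) :
    SuppLt (levels s) (n + 1) (stepMap (levels s) (connMats s) n y) :=
  fun _ hi => if_neg (not_lt.2 hi)

/-- Elements with the same image in `G` become equal after one step. -/
lemma step_eq_step (h : IsCoding x ε φ) (hs : IsStageSeq x s) (n : ℕ) (y z y' z' : ℕ → ℤ)
    (hyz : levelMap ε (s n) y + φ (levelMap ε (s n) z) =
      levelMap ε (s n) y' + φ (levelMap ε (s n) z')) (j : ℕ) (hj : j < (s (n + 1)).l) :
    ∑ i ∈ range (s n).l,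
        (((s (n + 1)).m (i, j) : ℤ) * y i + ((s (n + 1)).q (i, j) : ℤ) * z i) =
      ∑ i ∈ range (s n).l,
        (((s (n + 1)).m (i, j) : ℤ) * y' i + ((s (n + 1)).q (i, j) : ℤ) * z' i) := by
  obtain ⟨vec, hvec⟩ : ∃ vec : (ℕ → ℤ) → ℕ →₀ ℕ,
      ∀ v : ℕ → ℤ, ∀ i < (s n).l, (vec v i : ℤ) = ((v i).toNat : ℤ) :=
    ⟨fun v => extendVec fun i : Fin (s n).l => (v i).toNat, fun v i hi =>
      congrArg Nat.cast (extendVec_coe (fun i : Fin (s n).l => (v i).toNat) ⟨i, hi⟩)⟩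
  have hmap : ∀ v : ℕ → ℤ, ε (codeSum x.1.1 (s n).e (s n).θ (vec v) (s n).l) =
      levelMap ε (s n) fun i => ((v i).toNat : ℤ) := fun v => by
    rw [h.map_codeSum_eq_levelMap (hs.isStage n)]
    exact sum_congr rfl fun i hi => congrArg (· • _) (hvec v i (mem_range.1 hi))
  have hdec : ∀ v : ℤ, (v.toNat : ℤ) - ((-v).toNat : ℤ) = v := fun v => by omega
  have hdiff : ∀ v : ℕ → ℤ, levelMap ε (s n) (fun i => ((v i).toNat : ℤ)) -
      levelMap ε (s n) (fun i => ((-v i).toNat : ℤ)) = levelMap ε (s n) v := fun v => by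
    rw [← levelMap_sub]
    simp only [hdec]
  have hv : ∀ v : ℕ → ℤ, levelMap ε (s n) (fun i => ((v i).toNat : ℤ)) =
      levelMap ε (s n) v + levelMap ε (s n) (fun i => ((-v i).toNat : ℤ)) := fun v => by
    rw [← hdiff v]; abel
  have key := (hs.2 n).2.2.2.2.2.2.1 (vec y + vec fun i => - y' i)
    (vec z + vec fun i => - z' i) (vec y' + vec fun i => - y i) (vec z' + vec fun i => - z i) (by
      have hadd : ∀ a b : ℕ →₀ ℕ, ε (codeSum x.1.1 (s n).e (s n).θ (a + b : ℕ →₀ ℕ) (s n).l) =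
          ε (codeSum x.1.1 (s n).e (s n).θ a (s n).l) +
          ε (codeSum x.1.1 (s n).e (s n).θ b (s n).l) := fun a b => by
        simp only [h.map_codeSum_eq_levelMap (hs.isStage n), ← levelMap_add]
        simp
      apply ε.injective
      simp only [h.map_add, h.map_endo, hadd, hmap, map_add]
      simp only [hv y, hv z, hv y', hv z', map_add]
      rw [← sub_eq_zero] at hyz ⊢
      rw [← hyz]
      abel) j hj
  zify at key
  rw [← sub_eq_zero, ← sum_sub_distrib] at key ⊢
  rw [← key]
  refine sum_congr rfl fun i hi => ?_
  have hi := mem_range.1 hi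
  simp only [Pi.add_apply, Nat.cast_add, hvec _ i hi]
  have a1 := hdec (y i)
  have a2 := hdec (z i)
  have a3 := hdec (y' i)
  have a4 := hdec (z' i)
  linear_combination (-(((s (n + 1)).m (i, j) : ℤ))) * a1 - ((s (n + 1)).q (i, j) : ℤ) * a2 +
    ((s (n + 1)).m (i, j) : ℤ) * a3 + ((s (n + 1)).q (i, j) : ℤ) * a4

lemma stepMap_eq_stepMap (h : IsCoding x ε φ) (hs : IsStageSeq x s) (n : ℕ) (y z : ℕ → ℤ)
    (hyz : levelMap ε (s n) y = levelMap ε (s n) z) :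
    stepMap (levels s) (connMats s) n y = stepMap (levels s) (connMats s) n z := by
  ext j
  by_cases hj : j < (s (n + 1)).l
  · have := step_eq_step h hs n y 0 z 0 (by rw [hyz]) j hj
    simpa [stepMap, hj] using this
  · simp [stepMap, hj]

lemma levelMap_iterStep (h : IsCoding x ε φ) (hs : IsStageSeq x s) (n k : ℕ) (y : ℕ → ℤ) :
    levelMap ε (s (n + k)) (iterStep (levels s) (connMats s) n k y) = levelMap ε (s n) y := by
  induction k with
  | zero => rfl
  | succ k ih => exact (levelMap_stepMap h hs (n + k) _).trans ih

lemma levelMap_nonneg [IsOrderedAddMonoid G] (h : IsCoding x ε φ) {s : Stage} (hs : IsStage x s)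
    {y : ℕ → ℤ} (hy : ∀ j, 0 ≤ y j) : 0 ≤ levelMap ε s y :=
  sum_nonneg fun i hi => zsmul_nonneg ((h.pos_iff _).1 (hs.2.2.1 i (mem_range.1 hi))) (hy i)

lemma stepMap_nonneg (n : ℕ) {y : ℕ → ℤ} (hy : ∀ j, 0 ≤ y j) (j : ℕ) :
    0 ≤ stepMap (levels s) (connMats s) n y j := by
  unfold stepMap
  split_ifs
  · exact sum_nonneg fun i _ => mul_nonneg (Int.natCast_nonneg _) (hy i)
  · exact le_rfl

lemma exists_nonneg_preimage (h : IsCoding x ε φ) (hs : IsStageSeq x s) (g : G) (hg : 0 ≤ g) :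
    ∃ N, ∀ n, N ≤ n → ∃ y, SuppLt (levels s) n y ∧ (∀ j, 0 ≤ y j) ∧ levelMap ε (s n) y = g := by
  obtain ⟨N, rfl⟩ := ε.surjective g
  refine ⟨N + 1, fun n hn => ?_⟩
  induction n, hn using Nat.le_induction with
  | base =>
    obtain ⟨c, hc⟩ := (hs.2 N).2.2.2.2.2.2.2 ((h.pos_iff N).2 hg)
    refine ⟨fun i => if i < (s (N + 1)).l then (c i : ℤ) else 0, fun i hi => if_neg (not_lt.2 hi),
      fun j => by positivity, ?_⟩
    refine Eq.trans ?_ (congrArg ε hc)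
    rw [h.map_codeSum_eq_levelMap (hs.isStage _)]
    exact sum_congr rfl fun i hi => congrArg (· • _) (if_pos (mem_range.1 hi))
  | succ n _ ih =>
    obtain ⟨y, -, hy0, hy⟩ := ih
    exact ⟨_, suppLt_stepMap n y, stepMap_nonneg n hy0, (levelMap_stepMap h hs n y).trans hy⟩

/-- The Bratteli diagram with endomorphism given by a sequence of levels. -/
def stageDiagram (s : ℕ → Stage) :
    ((ℕ → ℕ) × (ℕ → ℕ → ℕ) × (ℕ → ℕ × ℕ → ℕ)) × (ℕ → ℕ × ℕ → ℕ) :=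
  ((levels s, fun n i => (s n).w i, connMats s), endoMats s)

lemma stageDiagram_mem (h : IsCoding x ε φ) (hs : IsStageSeq x s) :
    stageDiagram s ∈ EndBDCode := by
  refine ⟨⟨hs.1.2.1, hs.1.2.2, fun n i => (hs.isStage n).2.1 i, fun n i j => (hs.2 n).2.2.1 i j,
    fun n j => (hs.2 n).2.2.2.1 j⟩, fun n i t' hi ht' => ?_⟩
  have hq : levelMap ε (s (n + 1)) (fun j => ((s (n + 1)).q (i, j) : ℤ)) = φ (ε ((s n).θ i)) := by
    rw [← h.map_codeSum_eq_levelMap (hs.isStage _), (hs.2 n).2.2.2.2.2.1 i hi, h.map_endo]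
  have hm : levelMap ε (s (n + 1)) (fun j => ((s (n + 1)).m (i, j) : ℤ)) = ε ((s n).θ i) := by
    rw [← h.map_codeSum_eq_levelMap (hs.isStage _), (hs.2 n).2.2.2.2.1 i hi]
  have h0 : levelMap ε (s (n + 1)) 0 = 0 := by simp [levelMap]
  have := step_eq_step h hs (n + 1) 0 (fun j => ((s (n + 1)).m (i, j) : ℤ))
    (fun j => ((s (n + 1)).q (i, j) : ℤ)) 0 (by rw [hq, hm, h0]; simp) t' ht'
  simp only [Pi.zero_apply, mul_zero, zero_add, add_zero] at this
  simp only [stageDiagram]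
  zify
  calc _ = _ := sum_congr rfl fun t _ => mul_comm _ _
    _ = _ := this
    _ = _ := sum_congr rfl fun t _ => mul_comm _ _

lemma isLimitIso_stageDiagram [IsOrderedAddMonoid G] (h : IsCoding x ε φ) (hs : IsStageSeq x s)
    (hdir : ∀ g : G, ∃ a b, 0 ≤ a ∧ 0 ≤ b ∧ g + b = a) :
    IsLimitIso (stageDiagram s).1.1 (stageDiagram s).1.2.1 (stageDiagram s).1.2.2
      x.1.1 x.1.2.1 x.1.2.2 (fun n y => ε.symm (levelMap ε (s n) y)) := by
  intro e he
  have he0 := h.map_identity he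
  have hzero : ∀ n, levelMap ε (s n) (fun _ => 0) = 0 := fun n => by simp [levelMap]
  refine ⟨fun n y z _ _ => ε.injective ?_, fun n y _ => congrArg ε.symm ?_, fun g => ?_,
    fun n y _ => ⟨fun hy => ⟨1, ?_⟩, ?_⟩, fun n y _ => ⟨fun hy => ?_, ?_⟩, ?_⟩
  · rw [h.map_add]
    simp [levelMap_add]
  · exact levelMap_stepMap h hs n y
  · obtain ⟨a, b, ha, hb, hab⟩ := hdir (ε g)
    obtain ⟨N, hN⟩ := exists_nonneg_preimage h hs a ha
    obtain ⟨M, hM⟩ := exists_nonneg_preimage h hs b hb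
    obtain ⟨y, hys, -, hy⟩ := hN (max N M) (le_max_left _ _)
    obtain ⟨z, hzs, -, hz⟩ := hM (max N M) (le_max_right _ _)
    refine ⟨max N M, fun i => y i - z i, fun i hi => ?_, ?_⟩
    · simp only [hys i hi, hzs i hi, sub_zero]
    simp only
    rw [levelMap_sub, hy, hz, ← hab, add_sub_cancel_right, Equiv.symm_apply_apply]
  · refine (stepMap_eq_stepMap h hs n y (fun _ => 0) ?_).trans ?_
    · rw [hzero, ← he0, ← hy, Equiv.apply_symm_apply]
    · ext j
      simp [stepMap]
  · rintro ⟨k, hk⟩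
    rw [Equiv.symm_apply_eq, he0, ← levelMap_iterStep h hs n k y]
    exact (congrArg _ hk).trans (hzero _)
  · rw [h.pos_iff, Equiv.apply_symm_apply] at hy
    obtain ⟨N, hN⟩ := exists_nonneg_preimage h hs _ hy
    obtain ⟨z, -, hz0, hz⟩ := hN (n + N) (Nat.le_add_left _ _)
    refine ⟨N + 1, fun j => ?_⟩
    have : iterStep (levels s) (connMats s) n (N + 1) y =
        stepMap (levels s) (connMats s) (n + N) z :=
      stepMap_eq_stepMap h hs (n + N) _ z (by rw [hz, levelMap_iterStep h hs])
    exact (stepMap_nonneg (n + N) hz0 j).trans_eq (congrFun this j).symm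
  · rintro ⟨k, hk⟩
    rw [h.pos_iff, Equiv.apply_symm_apply, ← levelMap_iterStep h hs n k y]
    exact levelMap_nonneg h (hs.isStage _) hk
  · rw [Equiv.symm_apply_eq, ← (hs.isStage 0).2.2.2, h.map_codeSum_eq_levelMap (hs.isStage 0)]
    exact sum_congr rfl fun i hi => congrArg (· • _) (if_pos (mem_range.1 hi))

lemma measurable_stageDiagram {X : Type} [MeasurableSpace X] {S : ℕ → X → Stage}
    (hS : ∀ n, Measurable (S n)) : Measurable fun a => stageDiagram fun n => S n a := by
  have key : ∀ (n : ℕ) (F : Stage → ℕ), Measurable fun a => F (S n a) := fun n F =>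
    (measurable_from_top (f := F)).comp (hS n)
  refine .prodMk (.prodMk ?_ (.prodMk ?_ ?_)) ?_
  · exact measurable_pi_iff.2 fun n => key n Stage.l
  · exact measurable_pi_iff.2 fun n => measurable_pi_iff.2 fun i => key n fun s => s.w i
  · exact measurable_pi_iff.2 fun n => measurable_pi_iff.2 fun p => key (n + 1) fun s => s.m p
  · exact measurable_pi_iff.2 fun n => measurable_pi_iff.2 fun p => key (n + 1) fun s => s.q p

end Limit

/-- There is a Borel map `End_𝒟𝒢 → End_𝓑𝒟` assigning to every
dimension group `G` with a positive endomorphism `φ` a Bratteli diagram `T` with an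
endomorphism `q` such that the dimension group associated with `T` is isomorphic to `G`
(as ordered abelian groups with order unit) via an isomorphism `θ` intertwining the
endomorphism `ψ` induced by `q` with `φ`, i.e. `θ ∘ ψ = φ ∘ θ`.  As in `IsLimitIso`, the
isomorphism is coded by its compositions `θ n` with the canonical maps
`ℤ^{l(n)} → lim`; since `ψ ∘ φ_{n,∞} = φ_{n+1,∞} ∘ ψ_n`, the intertwining condition
reads `θ (n+1) (ψ_n x) = φ (θ n x)`. -/
theorem stmt12 :
    ∃ F : (((ℕ × ℕ → ℕ) × (ℕ → Bool) × ℕ) × (ℕ → ℕ)) →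
        ((ℕ → ℕ) × (ℕ → ℕ → ℕ) × (ℕ → ℕ × ℕ → ℕ)) × (ℕ → ℕ × ℕ → ℕ),
      Measurable F ∧
        ∀ x ∈ EndDGCode, F x ∈ EndBDCode ∧
          ∃ θ : ℕ → (ℕ → ℤ) → ℕ,
            IsLimitIso (F x).1.1 (F x).1.2.1 (F x).1.2.2 x.1.1 x.1.2.1 x.1.2.2 θ ∧
            ∀ n y, SuppLt (F x).1.1 n y →
              θ (n + 1) (qStep (F x).1.1 (F x).2 n y) = x.2 (θ n y) := by
  obtain ⟨S, hS, h0, hnext⟩ := exists_measurable_stages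
  refine ⟨fun x => stageDiagram fun n => S n x, measurable_stageDiagram hS, fun x hx => ?_⟩
  obtain ⟨G, _, _, _, ε, φ, h, hI, hU, hφ, hu, hu0, hdir⟩ := exists_coding x hx
  have hs : IsStageSeq x fun n => S n x := by
    obtain ⟨e, he, -⟩ := hx.1.1.2
    have hinit := h0 x (exists_isInitialStage h hu0 he)
    have hstage : ∀ n, IsStage x (S n x) := fun n => by
      induction n with
      | zero => exact hinit.1
      | succ n ih => exact (hnext n x (exists_isNextStage h hI hU hφ hu n _ ih)).1
    exact ⟨hinit, fun n => hnext n x (exists_isNextStage h hI hU hφ hu n _ (hstage n))⟩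
  refine ⟨stageDiagram_mem h hs, _, isLimitIso_stageDiagram h hs hdir, fun n y _ => ?_⟩
  rw [Equiv.symm_apply_eq, h.map_endo, Equiv.apply_symm_apply]
  exact levelMap_qStep h hs n y
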